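/- arXiv:2106.12539 — 4 statements merged into one kernel-verified Lean document; each statement's English description precedes it below -/
import Mathlib

section
/- If Σ = (G, σ) is a distance compatible signed graph, then dim(Σ) = dim(−Σ), where −Σ = (G, −σ) is the negation of Σ (obtained by reversing the sign of every edge). That is, the metric dimension of a signed graph is invariant under negation. -/
open SimpleGraph
open scoped Classical

/-- The sign of a walk: the product of the signs of its edges. -/
def SimpleGraph.walkSign {V : Type*} {G : SimpleGraph V} (σ : Sym2 V → ℤ) {u v : V}
    (p : G.Walk u v) : ℤ :=
  (p.edges.map σ).prod

/-- σ_max: `-1` if every shortest `u–v` path has sign `-1`, and `+1` otherwise. -/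
noncomputable def SimpleGraph.sigmaMax {V : Type*} (G : SimpleGraph V) (σ : Sym2 V → ℤ)
    (u v : V) : ℤ :=
  if ∀ p : G.Walk u v, p.length = G.dist u v → SimpleGraph.walkSign σ p = -1 then -1 else 1

/-- σ_min: `+1` if every shortest `u–v` path has sign `+1`, and `-1` otherwise. -/
noncomputable def SimpleGraph.sigmaMin {V : Type*} (G : SimpleGraph V) (σ : Sym2 V → ℤ)
    (u v : V) : ℤ :=
  if ∀ p : G.Walk u v, p.length = G.dist u v → SimpleGraph.walkSign σ p = 1 then 1 else -1

/-- The signed distance `d^max`. -/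
noncomputable def SimpleGraph.dmax {V : Type*} (G : SimpleGraph V) (σ : Sym2 V → ℤ)
    (u v : V) : ℤ :=
  G.sigmaMax σ u v * G.dist u v

/-- The signed distance `d^min`. -/
noncomputable def SimpleGraph.dmin {V : Type*} (G : SimpleGraph V) (σ : Sym2 V → ℤ)
    (u v : V) : ℤ :=
  G.sigmaMin σ u v * G.dist u v

/-- A signed graph `(G, σ)` is distance compatible if `d^max = d^min` for all pairs. -/
def SimpleGraph.DistCompatible {V : Type*} (G : SimpleGraph V) (σ : Sym2 V → ℤ) : Prop :=
  ∀ u v : V, G.dmax σ u v = G.dmin σ u v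

/-- The signed distance of a (distance compatible) signed graph. -/
noncomputable def SimpleGraph.sdist {V : Type*} (G : SimpleGraph V) (σ : Sym2 V → ℤ)
    (u v : V) : ℤ :=
  G.dmax σ u v

/-- `W` is a resolving set of the signed graph `(G, σ)`: distinct vertices get distinct
vectors of signed distances to the vertices of `W`. -/
def SimpleGraph.SResolves {V : Type*} (G : SimpleGraph V) (σ : Sym2 V → ℤ) (W : Set V) : Prop :=
  ∀ u v : V, (∀ w ∈ W, G.sdist σ u w = G.sdist σ v w) → u = v

/-- `W` is a resolving set of the (unsigned) graph `G`. -/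
def SimpleGraph.UResolves {V : Type*} (G : SimpleGraph V) (W : Set V) : Prop :=
  ∀ u v : V, (∀ w ∈ W, G.dist u w = G.dist v w) → u = v

/-- The metric dimension of the signed graph `(G, σ)`. -/
noncomputable def SimpleGraph.sdim {V : Type*} [Fintype V] (G : SimpleGraph V)
    (σ : Sym2 V → ℤ) : ℕ :=
  sInf {k | ∃ W : Finset V, W.card = k ∧ G.SResolves σ ↑W}

/-- The metric dimension of the (unsigned) graph `G`. -/
noncomputable def SimpleGraph.udim {V : Type*} [Fintype V] (G : SimpleGraph V) : ℕ :=
  sInf {k | ∃ W : Finset V, W.card = k ∧ G.UResolves ↑W}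

/-- Negating every edge multiplies the sign of a walk by `(-1) ^ length`. -/
theorem SimpleGraph.walkSign_neg {V : Type*} {G : SimpleGraph V} (σ : Sym2 V → ℤ) {u v : V}
    (p : G.Walk u v) :
    SimpleGraph.walkSign (fun e => -σ e) p = (-1) ^ p.length * SimpleGraph.walkSign σ p := by
  unfold SimpleGraph.walkSign
  induction p with
  | nil => simp
  | cons h p ih =>
    simp only [Walk.edges_cons, List.map_cons, List.prod_cons, Walk.length_cons, ih]
    ring

theorem SimpleGraph.sigmaMax_eq_or {V : Type*} (G : SimpleGraph V) (σ : Sym2 V → ℤ) (u v : V) :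
    G.sigmaMax σ u v = 1 ∨ G.sigmaMax σ u v = -1 := by
  unfold SimpleGraph.sigmaMax
  split_ifs <;> simp

theorem SimpleGraph.natAbs_sdist {V : Type*} (G : SimpleGraph V) (σ : Sym2 V → ℤ) (u v : V) :
    (G.sdist σ u v).natAbs = G.dist u v := by
  unfold SimpleGraph.sdist SimpleGraph.dmax
  rcases G.sigmaMax_eq_or σ u v with h | h <;> simp [h]

/-- In a distance compatible signed graph all shortest paths between two distinct vertices
have the sign `σ_max`. -/
theorem SimpleGraph.DistCompatible.walkSign_eq {V : Type*} {G : SimpleGraph V}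
    {σ : Sym2 V → ℤ} (hcomp : G.DistCompatible σ) {u v : V} (hd : G.dist u v ≠ 0)
    (p : G.Walk u v) (hp : p.length = G.dist u v) :
    SimpleGraph.walkSign σ p = G.sigmaMax σ u v := by
  have h : G.sigmaMax σ u v = G.sigmaMin σ u v :=
    mul_right_cancel₀ (Nat.cast_ne_zero.mpr hd) (hcomp u v)
  by_cases hmax : ∀ p : G.Walk u v, p.length = G.dist u v → SimpleGraph.walkSign σ p = -1
  · rw [SimpleGraph.sigmaMax, if_pos hmax, hmax p hp]
  · by_cases hmin : ∀ p : G.Walk u v, p.length = G.dist u v → SimpleGraph.walkSign σ p = 1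
    · rw [SimpleGraph.sigmaMax, if_neg hmax, hmin p hp]
    · simp [SimpleGraph.sigmaMax, SimpleGraph.sigmaMin, if_neg hmax, if_neg hmin] at h

/-- If all shortest `u–v` walks have the same sign `s = ±1`, then `σ_max = s`. -/
theorem SimpleGraph.Connected.sigmaMax_eq {V : Type*} {G : SimpleGraph V} (hconn : G.Connected)
    {σ : Sym2 V → ℤ} {u v : V} {s : ℤ} (hs : s = 1 ∨ s = -1)
    (h : ∀ p : G.Walk u v, p.length = G.dist u v → SimpleGraph.walkSign σ p = s) :
    G.sigmaMax σ u v = s := by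
  unfold SimpleGraph.sigmaMax
  rcases hs with rfl | rfl
  · obtain ⟨p, hp⟩ := hconn.exists_walk_length_eq_dist u v
    rw [if_neg]
    intro h'
    have := (h p hp).symm.trans (h' p hp)
    norm_num at this
  · exact if_pos h

theorem SimpleGraph.DistCompatible.sdist_neg {V : Type*} {G : SimpleGraph V}
    (hconn : G.Connected) {σ : Sym2 V → ℤ} (hcomp : G.DistCompatible σ) (u v : V) :
    G.sdist (fun e => -σ e) u v = (-1) ^ G.dist u v * G.sdist σ u v := by
  unfold SimpleGraph.sdist SimpleGraph.dmax
  by_cases hd : G.dist u v = 0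
  · simp [hd]
  rw [hconn.sigmaMax_eq (s := (-1) ^ G.dist u v * G.sigmaMax σ u v), mul_assoc]
  · rcases neg_one_pow_eq_or ℤ (G.dist u v) with h | h <;>
      rcases G.sigmaMax_eq_or σ u v with h' | h' <;> simp [h, h']
  · intro p hp
    rw [SimpleGraph.walkSign_neg, hp, hcomp.walkSign_eq hd p hp]

theorem SimpleGraph.DistCompatible.sdist_neg_eq_iff {V : Type*} {G : SimpleGraph V}
    (hconn : G.Connected) {σ : Sym2 V → ℤ} (hcomp : G.DistCompatible σ) (u v w : V) :
    G.sdist (fun e => -σ e) u w = G.sdist (fun e => -σ e) v w ↔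
      G.sdist σ u w = G.sdist σ v w := by
  constructor <;> intro h
  · have hd : G.dist u w = G.dist v w := by
      rw [← G.natAbs_sdist (fun e => -σ e) u w, h, G.natAbs_sdist]
    rw [hcomp.sdist_neg hconn, hcomp.sdist_neg hconn, hd] at h
    exact mul_left_cancel₀ (pow_ne_zero _ (by norm_num)) h
  · have hd : G.dist u w = G.dist v w := by
      rw [← G.natAbs_sdist σ u w, h, G.natAbs_sdist]
    rw [hcomp.sdist_neg hconn, hcomp.sdist_neg hconn, hd, h]

/-- The metric dimension of a distance compatible signed graph is invariant under
negation: `dim(Σ) = dim(-Σ)`. -/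
theorem sdim_negation {V : Type*} [Fintype V]
    (G : SimpleGraph V) (hconn : G.Connected)
    (σ : Sym2 V → ℤ) (hσ : ∀ e ∈ G.edgeSet, σ e = 1 ∨ σ e = -1)
    (hcomp : G.DistCompatible σ) :
    G.sdim σ = G.sdim (fun e => -σ e) := by
  simp only [SimpleGraph.sdim, SimpleGraph.SResolves, hcomp.sdist_neg_eq_iff hconn]
end

section
/- The metric dimension of the all-negative signed cycle on n ≥ 3 vertices (the signed graph whose underlying graph is the cycle C_n and in which every edge has sign −1) equals 2. -/
open SimpleGraph
open scoped Classical

/-- A walk in an all-negative signed graph has sign `(-1) ^ length`. -/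
theorem SimpleGraph.walkSign_neg_one {V : Type*} {G : SimpleGraph V} {u v : V} (p : G.Walk u v) :
    SimpleGraph.walkSign (fun _ => -1) p = (-1) ^ p.length := by
  simp [SimpleGraph.walkSign]

theorem SimpleGraph.Connected.sdist_neg_one {V : Type*} {G : SimpleGraph V} (hG : G.Connected)
    (u v : V) : G.sdist (fun _ => -1) u v = (-1) ^ G.dist u v * G.dist u v := by
  obtain ⟨p, hp⟩ := hG.exists_walk_length_eq_dist u v
  unfold SimpleGraph.sdist SimpleGraph.dmax SimpleGraph.sigmaMax
  congr 1
  split_ifs with h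
  · rw [← hp, ← SimpleGraph.walkSign_neg_one, h p hp]
  · rcases neg_one_pow_eq_or ℤ (G.dist u v) with h1 | h1
    · exact h1.symm
    · exact absurd (fun q hq => by rw [SimpleGraph.walkSign_neg_one, hq, h1]) h

theorem SimpleGraph.Connected.natAbs_sdist_neg_one {V : Type*} {G : SimpleGraph V}
    (hG : G.Connected) (u v : V) : (G.sdist (fun _ => -1) u v).natAbs = G.dist u v := by
  simp [hG.sdist_neg_one, Int.natAbs_mul, Int.natAbs_pow]

/-- Resolving sets of a connected all-negative signed graph are those of the underlying graph. -/
theorem SimpleGraph.Connected.sResolves_neg_one_iff {V : Type*} {G : SimpleGraph V}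
    (hG : G.Connected) (W : Set V) : G.SResolves (fun _ => -1) W ↔ G.UResolves W := by
  have key (u v w : V) : G.sdist (fun _ => -1) u w = G.sdist (fun _ => -1) v w ↔
      G.dist u w = G.dist v w := by
    refine ⟨fun h => ?_, fun h => ?_⟩
    · rw [← hG.natAbs_sdist_neg_one, h, hG.natAbs_sdist_neg_one]
    · rw [hG.sdist_neg_one, h, hG.sdist_neg_one]
  simp only [SimpleGraph.SResolves, SimpleGraph.UResolves, key]

theorem Fin.val_sub_eq_ite {n : ℕ} (a b : Fin n) :
    (a - b).val = if b.val ≤ a.val then a.val - b.val else n + a.val - b.val := by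
  split_ifs with h
  · exact Fin.sub_val_of_le h
  · exact Fin.coe_sub_iff_lt.2 (not_le.1 h)

theorem SimpleGraph.min_le_length_of_cycleGraph_walk {n : ℕ} {u v : Fin n}
    (p : (cycleGraph n).Walk u v) :
    min (Nat.dist u v) (n - Nat.dist u v) ≤ p.length := by
  induction p with
  | nil => simp
  | @cons a b c h p ih =>
    rw [cycleGraph_adj', Fin.val_sub_eq_ite, Fin.val_sub_eq_ite] at h
    rw [Walk.length_cons]
    unfold Nat.dist at *
    have ha := a.isLt
    have hb := b.isLt
    have hc := c.isLt
    split_ifs at h <;> omega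

theorem SimpleGraph.cycleGraph_dist_add_le {n a : ℕ} (k : ℕ) (h : a + k < n) :
    (cycleGraph n).dist ⟨a, by omega⟩ ⟨a + k, h⟩ ≤ k := by
  induction k with
  | zero => simp
  | succ k ih =>
    obtain ⟨m, rfl⟩ : ∃ m, n = m + 1 := ⟨n - 1, by omega⟩
    have hadj : (cycleGraph (m + 1)).Adj ⟨a + k, by omega⟩ ⟨a + (k + 1), h⟩ := by
      rw [cycleGraph_adj', Fin.val_sub_eq_ite, Fin.val_sub_eq_ite]
      right
      simp only
      split_ifs <;> omega
    have h1 := ih (by omega)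
    have h2 := cycleGraph_connected.dist_triangle (u := (⟨a, by omega⟩ : Fin (m + 1)))
      (v := ⟨a + k, by omega⟩) (w := ⟨a + (k + 1), h⟩)
    rw [dist_eq_one_iff_adj.2 hadj] at h2
    omega

theorem SimpleGraph.cycleGraph_dist_of_le {n : ℕ} {u v : Fin (n + 2)} (h : u ≤ v) :
    (cycleGraph (n + 2)).dist u v = min (v.val - u.val) (n + 2 - (v.val - u.val)) := by
  have huv : u.val ≤ v.val := h
  have hv := v.isLt
  have hG : (cycleGraph (n + 2)).Connected := cycleGraph_connected
  apply le_antisymm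
  · refine le_min ?_ ?_
    · have h1 := cycleGraph_dist_add_le (n := n + 2) (a := u) (v - u) (by omega)
      simpa [Nat.add_sub_cancel' huv] using h1
    · have hadj : (cycleGraph (n + 2)).Adj 0 (Fin.last (n + 1)) := by
        simp [cycleGraph_adj]
      have h1 := cycleGraph_dist_add_le (n := n + 2) (a := 0) u (by omega)
      have h2 := cycleGraph_dist_add_le (n := n + 2) (a := v) (n + 1 - v) (by omega)
      have e : (⟨v + (n + 1 - v), by omega⟩ : Fin (n + 2)) = Fin.last (n + 1) := by
        ext; simp; omega
      have e' : (⟨0 + u, by omega⟩ : Fin (n + 2)) = u := by ext; simp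
      rw [e, Fin.eta, dist_comm] at h2
      rw [e', dist_comm] at h1
      have h3 := hG.dist_triangle (u := u) (v := 0) (w := v)
      have h4 := hG.dist_triangle (u := 0) (v := Fin.last (n + 1)) (w := v)
      rw [dist_eq_one_iff_adj.2 hadj] at h4
      change (cycleGraph (n + 2)).dist u 0 ≤ _ at h1
      omega
  · obtain ⟨p, hp⟩ := hG.exists_walk_length_eq_dist u v
    have h1 := min_le_length_of_cycleGraph_walk p
    unfold Nat.dist at h1
    omega

/-- Two adjacent vertices resolve a cycle. -/
theorem SimpleGraph.cycleGraph_uResolves_pair (m : ℕ) :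
    (cycleGraph (m + 3)).UResolves {0, 1} := by
  intro u v h
  have h0 := h 0 (by simp)
  have h1 := h 1 (by simp)
  have d0 (x : Fin (m + 3)) : (cycleGraph (m + 3)).dist x 0 = min x.val (m + 3 - x.val) := by
    rw [dist_comm, cycleGraph_dist_of_le (Fin.zero_le x)]
    simp
  have d1 (x : Fin (m + 3)) (hx : x.val ≠ 0) :
      (cycleGraph (m + 3)).dist x 1 = min (x.val - 1) (m + 3 - (x.val - 1)) := by
    rw [dist_comm, cycleGraph_dist_of_le (by rw [Fin.le_def]; simp; omega)]
    simp
  rw [d0, d0] at h0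
  have hu := u.isLt
  have hv := v.isLt
  ext
  by_cases hu0 : u.val = 0
  · omega
  by_cases hv0 : v.val = 0
  · omega
  rw [d1 u hu0, d1 v hv0] at h1
  omega

theorem SimpleGraph.not_cycleGraph_uResolves_singleton {m : ℕ} (w : Fin (m + 3)) :
    ¬ (cycleGraph (m + 3)).UResolves {w} := by
  intro h
  have h1 : w + 1 = w - 1 := by
    refine h _ _ fun x hx => ?_
    rw [Set.mem_singleton_iff] at hx
    subst hx
    rw [dist_eq_one_iff_adj.2 (by simp [cycleGraph_adj]),
      dist_eq_one_iff_adj.2 (by simp [cycleGraph_adj])]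
  have h2 : (1 + 1 : Fin (m + 3)) = 0 := by
    apply add_left_cancel (a := w)
    rw [← add_assoc, h1, sub_add_cancel, add_zero]
  simp [Fin.ext_iff, Fin.val_add, Nat.mod_eq_of_lt (show 2 < m + 3 by omega)] at h2

/-- The metric dimension of the all-negative signed cycle on `n ≥ 3` vertices is `2`. -/
theorem sdim_allNegative_cycle (n : ℕ) (hn : 3 ≤ n) :
    (SimpleGraph.cycleGraph n).sdim (fun _ => -1) = 2 := by
  obtain ⟨m, rfl⟩ : ∃ m, n = m + 3 := ⟨n - 3, by omega⟩
  have hG : (cycleGraph (m + 3)).Connected := cycleGraph_connected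
  unfold SimpleGraph.sdim
  simp only [hG.sResolves_neg_one_iff]
  have hmem : 2 ∈ {k | ∃ W : Finset (Fin (m + 3)), W.card = k ∧
      (cycleGraph (m + 3)).UResolves (W : Set (Fin (m + 3)))} :=
    ⟨{0, 1}, by simp, by simpa using cycleGraph_uResolves_pair m⟩
  refine le_antisymm (Nat.sInf_le hmem) (le_csInf ⟨2, hmem⟩ ?_)
  rintro k ⟨W, rfl, hW⟩
  by_contra! hlt
  obtain ⟨w, hw⟩ := Finset.card_le_one_iff_subset_singleton.1 (Nat.le_of_lt_succ hlt)
  exact not_cycleGraph_uResolves_singleton w fun u v h =>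
    hW u v fun x hx => h x (by simpa using hw hx)
end

section
/- For every distance compatible signed complete graph K_n^σ = (K_n, σ) on n ≥ 4 vertices, the metric dimension satisfies 2 ≤ dim(K_n^σ) ≤ n − 1. -/
open SimpleGraph
open scoped Classical

theorem SimpleGraph.sdist_eq_zero_iff_of_connected {V : Type*} {G : SimpleGraph V}
    (hG : G.Connected) (σ : Sym2 V → ℤ) (u v : V) : G.sdist σ u v = 0 ↔ u = v := by
  unfold sdist dmax sigmaMax
  split_ifs <;> simp [hG.dist_eq_zero_iff]

theorem SimpleGraph.sdist_top_mem {V : Type*} (σ : Sym2 V → ℤ) (u v : V) :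
    (⊤ : SimpleGraph V).sdist σ u v ∈ ({-1, 0, 1} : Finset ℤ) := by
  unfold sdist dmax sigmaMax
  by_cases h : u = v
  · simp [h]
  · rw [dist_eq_one_iff_adj.mpr ((top_adj u v).mpr h)]
    split_ifs <;> simp

theorem SimpleGraph.SResolves.compl_singleton {V : Type*} {G : SimpleGraph V}
    (hG : G.Connected) (σ : Sym2 V → ℤ) (x : V) : G.SResolves σ {x}ᶜ := by
  intro u v h
  by_cases hu : u = x
  · by_cases hv : v = x
    · exact hu.trans hv.symm
    · exact (sdist_eq_zero_iff_of_connected hG σ u v).1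
        ((h v hv).trans ((sdist_eq_zero_iff_of_connected hG σ v v).2 rfl))
  · exact ((sdist_eq_zero_iff_of_connected hG σ v u).1
      ((h u hu).symm.trans ((sdist_eq_zero_iff_of_connected hG σ u u).2 rfl))).symm

theorem SimpleGraph.SResolves.card_le_three_pow {V : Type*} [Fintype V] {σ : Sym2 V → ℤ}
    {W : Finset V} (hW : (⊤ : SimpleGraph V).SResolves σ ↑W) :
    Fintype.card V ≤ 3 ^ W.card := by
  have hinj : Function.Injective fun (v : V) (w : W) =>
      (⟨(⊤ : SimpleGraph V).sdist σ v w, sdist_top_mem σ v w⟩ : ({-1, 0, 1} : Finset ℤ)) :=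
    fun u v h => hW u v fun w hw => congrArg Subtype.val (congrFun h ⟨w, hw⟩)
  simpa using Fintype.card_le_of_injective _ hinj

/-- For every distance compatible signed complete graph on `n ≥ 4` vertices,
`2 ≤ dim(K_n^σ) ≤ n - 1`. -/
theorem sdim_signed_complete {V : Type*} [Fintype V] (hn : 4 ≤ Fintype.card V)
    (σ : Sym2 V → ℤ) (hσ : ∀ e ∈ (⊤ : SimpleGraph V).edgeSet, σ e = 1 ∨ σ e = -1)
    (hcomp : (⊤ : SimpleGraph V).DistCompatible σ) :
    2 ≤ (⊤ : SimpleGraph V).sdim σ ∧ (⊤ : SimpleGraph V).sdim σ ≤ Fintype.card V - 1 := by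
  obtain ⟨x⟩ : Nonempty V := Fintype.card_pos_iff.mp (by omega)
  have hmem : Fintype.card V - 1 ∈
      {k | ∃ W : Finset V, W.card = k ∧ (⊤ : SimpleGraph V).SResolves σ ↑W} := by
    have : Nonempty V := ⟨x⟩
    refine ⟨{x}ᶜ, by simp [Finset.card_compl], ?_⟩
    simpa using SResolves.compl_singleton connected_top σ x
  refine ⟨le_csInf ⟨_, hmem⟩ ?_, Nat.sInf_le hmem⟩
  rintro _ ⟨W, rfl, hW⟩
  by_contra! hlt
  have hpow : 3 ^ W.card ≤ 3 ^ 1 := Nat.pow_le_pow_right (by norm_num) (by omega)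
  have hcard := hW.card_le_three_pow
  omega
end

section
/- For every signed tree T^σ = (T, σ), the metric dimension satisfies dim(T) − ext(T) ≤ dim(T^σ) ≤ dim(T), where ext(T) is the number of exterior major vertices of T; equivalently, mdd(T^σ) ≤ ext(T). -/
open SimpleGraph
open scoped Classical

/-- A major vertex: a vertex of degree at least `3`. -/
def SimpleGraph.IsMajor {V : Type*} [Fintype V] (G : SimpleGraph V) (v : V) : Prop :=
  3 ≤ G.degree v

/-- A leaf: a vertex of degree `1`. -/
def SimpleGraph.IsLeaf {V : Type*} [Fintype V] (G : SimpleGraph V) (v : V) : Prop :=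
  G.degree v = 1

/-- `u` is a terminal vertex of the major vertex `v`: `u` is a leaf and `u` is strictly
closer to `v` than to every other major vertex. -/
def SimpleGraph.IsTerminalOf {V : Type*} [Fintype V] (G : SimpleGraph V) (u v : V) : Prop :=
  G.IsLeaf u ∧ G.IsMajor v ∧ ∀ w : V, G.IsMajor w → w ≠ v → G.dist u v < G.dist u w

/-- The terminal degree of a vertex: the number of its terminal vertices. -/
noncomputable def SimpleGraph.terDegree {V : Type*} [Fintype V] (G : SimpleGraph V)
    (v : V) : ℕ :=
  {u : V | G.IsTerminalOf u v}.ncard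

/-- An exterior major vertex: a major vertex of positive terminal degree. -/
def SimpleGraph.IsExteriorMajor {V : Type*} [Fintype V] (G : SimpleGraph V) (v : V) : Prop :=
  G.IsMajor v ∧ 0 < G.terDegree v

/-- The number of exterior major vertices of `G`. -/
noncomputable def SimpleGraph.extMajor {V : Type*} [Fintype V] (G : SimpleGraph V) : ℕ :=
  {v : V | G.IsExteriorMajor v}.ncard

/-- In a tree, `u` lies on the leg from `v` to its terminal vertex `t` (i.e. on the
unique `v`–`t` path) iff `d(v,u) + d(u,t) = d(v,t)`. -/
def SimpleGraph.OnLeg {V : Type*} (G : SimpleGraph V) (v t u : V) : Prop :=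
  G.dist v u + G.dist u t = G.dist v t

/-- A special exterior major vertex of the signed tree `(G, σ)`: an exterior major
vertex `v` such that vertices with the same (positive) index on two different legs of
`v` always receive different signed distances from `v`. -/
noncomputable def SimpleGraph.IsSpecialExteriorMajor {V : Type*} [Fintype V]
    (G : SimpleGraph V) (σ : Sym2 V → ℤ) (v : V) : Prop :=
  G.IsExteriorMajor v ∧
    ∀ t t' : V, G.IsTerminalOf t v → G.IsTerminalOf t' v → t ≠ t' →
      ∀ u u' : V, G.OnLeg v t u → G.OnLeg v t' u' →
        G.dist v u = G.dist v u' → 0 < G.dist v u →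
          G.sdist σ v u ≠ G.sdist σ v u'

namespace SimpleGraph

/-! ### Distances and branches in trees -/

section Branch

variable {V : Type*} {G : SimpleGraph V}

/-- The branch at `u` in the direction of its neighbour `a`: the vertices that are closer to `a`
than to `u`. -/
def branch (G : SimpleGraph V) (u a : V) : Set V :=
  {x | G.dist x u = G.dist x a + 1}

theorem mem_branch {u a x : V} : x ∈ G.branch u a ↔ G.dist x u = G.dist x a + 1 := Iff.rfl

theorem mem_branch_self {u a : V} (h : G.Adj u a) : a ∈ G.branch u a := by
  simp [mem_branch, dist_eq_one_iff_adj.2 h.symm]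

theorem IsTree.walk_eq_of_length_eq_dist (hG : G.IsTree) {u v : V} {p q : G.Walk u v}
    (hp : p.length = G.dist u v) (hq : q.length = G.dist u v) : p = q :=
  congrArg Subtype.val ((hG.isAcyclic.subsingleton_path u v).elim
    ⟨p, p.isPath_of_length_eq_dist hp⟩ ⟨q, q.isPath_of_length_eq_dist hq⟩)

/-- A vertex of a tree lies in at most one branch at `m`. -/
theorem IsTree.eq_of_mem_branch (hG : G.IsTree) {m a b w : V} (ha : G.Adj m a) (hb : G.Adj m b)
    (hwa : w ∈ G.branch m a) (hwb : w ∈ G.branch m b) : a = b := by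
  obtain ⟨p, hp⟩ := hG.connected.exists_walk_length_eq_dist a w
  obtain ⟨q, hq⟩ := hG.connected.exists_walk_length_eq_dist b w
  rw [mem_branch, dist_comm, G.dist_comm (u := w)] at hwa hwb
  have h : Walk.cons ha p = Walk.cons hb q := hG.walk_eq_of_length_eq_dist
    (by simp [hp, hwa]) (by simp [hq, hwb])
  simpa using congrArg Walk.snd h

theorem IsTree.dist_eq_of_notMem_branch (hG : G.IsTree) {m a w : V} (ha : G.Adj m a)
    (hw : w ∉ G.branch m a) : G.dist w a = G.dist w m + 1 :=
  (hG.dist_eq_dist_add_one_of_adj w ha).resolve_left hw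

theorem Connected.exists_mem_branch (hG : G.Connected) {u w : V} (h : w ≠ u) :
    ∃ a, G.Adj u a ∧ w ∈ G.branch u a := by
  obtain ⟨p, hp⟩ := hG.exists_walk_length_eq_dist u w
  cases p with
  | nil => exact absurd rfl h
  | @cons _ a _ ha p =>
    refine ⟨a, ha, ?_⟩
    rw [Walk.length_cons] at hp
    have h₁ := G.dist_le p
    have h₂ := hG.dist_triangle (u := u) (v := a) (w := w)
    rw [dist_eq_one_iff_adj.2 ha] at h₂
    rw [mem_branch, dist_comm, G.dist_comm (u := w)]
    omega

/-- The edge `u a` lies on the path between a vertex outside and a vertex inside the branch. -/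
theorem IsTree.dist_eq_add_of_mem_branch (hG : G.IsTree) {u a w y : V} (ha : G.Adj u a)
    (hw : w ∉ G.branch u a) (hy : y ∈ G.branch u a) :
    G.dist w y = G.dist w u + G.dist u y := by
  have hc := hG.connected
  have hwa := hG.dist_eq_of_notMem_branch ha hw
  induction hn : G.dist y a generalizing y with
  | zero =>
    rw [hc.dist_eq_zero_iff] at hn
    subst hn
    rw [hwa, dist_eq_one_iff_adj.2 ha]
  | succ n ih =>
    have hya : a ≠ y := by rintro rfl; simp at hn
    obtain ⟨z, hyz, haz⟩ := hc.exists_mem_branch hya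
    rw [mem_branch] at haz hy
    have hzu : z ∈ G.branch u a := by
      have h₁ := hc.dist_triangle (u := z) (v := a) (w := u)
      have h₂ := hc.dist_triangle (u := y) (v := z) (w := u)
      rw [dist_eq_one_iff_adj.2 ha.symm] at h₁
      rw [dist_eq_one_iff_adj.2 hyz] at h₂
      rw [mem_branch]
      have := G.dist_comm (u := a) (v := y)
      have := G.dist_comm (u := a) (v := z)
      omega
    have hza : G.dist z a = n := by
      have := G.dist_comm (u := a) (v := y)
      have := G.dist_comm (u := a) (v := z)
      omega
    have h := ih hzu hza
    rw [mem_branch] at hzu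
    have huy := G.dist_comm (u := u) (v := y)
    have huz := G.dist_comm (u := u) (v := z)
    rcases hG.dist_eq_dist_add_one_of_adj w hyz with h' | h'
    · omega
    · exfalso
      have hne : u ≠ z := by rintro rfl; simp at hzu
      obtain ⟨t, hzt, hut⟩ := hc.exists_mem_branch hne
      rw [mem_branch] at hut
      have hwt : w ∈ G.branch z t := by
        have h₁ := hc.dist_triangle (u := w) (v := u) (w := t)
        have h₂ := hG.dist_eq_dist_add_one_of_adj w hzt
        rw [mem_branch]
        omega
      have hty := hG.eq_of_mem_branch hzt hyz.symm hwt h'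
      subst hty
      omega

/-- Two distinct vertices not resolved by a nonempty set have a common midpoint with two
branches missing that set. -/
theorem IsTree.exists_disjoint_branches (hG : G.IsTree) {W : Set V} {w₀ : V} (hw₀ : w₀ ∈ W)
    {x y : V} (hxy : x ≠ y) (h : ∀ w ∈ W, G.dist x w = G.dist y w) :
    ∃ m a b, G.Adj m a ∧ G.Adj m b ∧ a ≠ b ∧ (∀ w ∈ W, w ∉ G.branch m a) ∧
      ∀ w ∈ W, w ∉ G.branch m b := by
  have hc := hG.connected
  induction hn : G.dist x w₀ generalizing x y with
  | zero =>
    have h₁ := h _ hw₀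
    rw [hn] at h₁
    exact absurd ((hc.dist_eq_zero_iff.1 hn).trans (hc.dist_eq_zero_iff.1 h₁.symm).symm) hxy
  | succ n ih =>
    obtain ⟨x', hx, hyx⟩ := hc.exists_mem_branch hxy.symm
    obtain ⟨y', hy, hxy'⟩ := hc.exists_mem_branch hxy
    have key : ∀ {x x' y : V}, x ≠ y → G.Adj x x' → y ∈ G.branch x x' →
        (∀ w ∈ W, G.dist x w = G.dist y w) → ∀ w ∈ W, w ∈ G.branch x x' := by
      intro x x' y hxy hx hyx h w hw
      by_contra hcon
      have h₁ := hG.dist_eq_add_of_mem_branch hx hcon hyx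
      have h₂ := h w hw
      have h₃ := hc.pos_dist_of_ne hxy
      have h₄ := G.dist_comm (u := x) (v := w)
      have h₅ := G.dist_comm (u := y) (v := w)
      omega
    have kx := key hxy hx hyx h
    have ky := key hxy.symm hy hxy' fun w hw => (h w hw).symm
    have h' : ∀ w ∈ W, G.dist x' w = G.dist y' w ∧ G.dist x w = G.dist x' w + 1 := by
      intro w hw
      have h₁ := kx w hw
      have h₂ := ky w hw
      have h₃ := h w hw
      rw [mem_branch] at h₁ h₂
      simp only [G.dist_comm (u := w)] at h₁ h₂
      omega
    by_cases hne : x' = y'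
    · subst hne
      refine ⟨x', x, y, hx.symm, hy.symm, hxy, fun w hw hb => ?_, fun w hw hb => ?_⟩
      · have := kx w hw
        rw [mem_branch] at this hb
        omega
      · have := ky w hw
        rw [mem_branch] at this hb
        omega
    · refine ih hne (fun w hw => (h' w hw).1) ?_
      have := (h' _ hw₀).2
      omega

/-- A branch at a vertex `u` pointing away from `m` is contained in the branch at `m` containing
`u`. -/
theorem IsTree.branch_subset (hG : G.IsTree) {m a u c x : V} (hu : u ∈ G.branch m a)
    (hc : G.Adj u c) (hm : m ∉ G.branch u c) (hx : x ∈ G.branch u c) (ha : G.Adj m a) :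
    x ∈ G.branch m a ∧ G.dist m x = G.dist m u + G.dist u x := by
  have h := hG.dist_eq_add_of_mem_branch hc hm hx
  refine ⟨?_, h⟩
  have h₁ := hG.connected.dist_triangle (u := x) (v := u) (w := a)
  have h₂ := hG.dist_eq_dist_add_one_of_adj x ha
  have h₃ := G.dist_comm (u := x) (v := m)
  have h₄ := G.dist_comm (u := u) (v := m)
  have h₅ := G.dist_comm (u := x) (v := u)
  rw [mem_branch] at hu ⊢
  omega

end Branch

section Degree

variable {V : Type*} [Fintype V] {G : SimpleGraph V}

theorem exists_adj_ne_of_two_le_degree {u : V} (h : 2 ≤ G.degree u) (z : V) :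
    ∃ c, G.Adj u c ∧ c ≠ z := by
  rw [← card_neighborFinset_eq_degree] at h
  obtain ⟨c, hc, hcz⟩ := Finset.exists_mem_ne h z
  exact ⟨c, by simpa using hc, hcz⟩

theorem exists_adj_ne_of_three_le_degree {u : V} (h : 3 ≤ G.degree u) (z z' : V) :
    ∃ c, G.Adj u c ∧ c ≠ z ∧ c ≠ z' := by
  rw [← card_neighborFinset_eq_degree] at h
  have h₁ : 0 < (G.neighborFinset u \ {z, z'}).card := by
    have := Finset.le_card_sdiff {z, z'} (G.neighborFinset u)
    have := Finset.card_le_two (a := z) (b := z')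
    omega
  obtain ⟨c, hc⟩ := Finset.card_pos.1 h₁
  simp only [Finset.mem_sdiff, mem_neighborFinset, Finset.mem_insert, Finset.mem_singleton,
    not_or] at hc
  exact ⟨c, hc⟩

theorem eq_or_eq_of_degree_lt_three {m a b c : V} (h : G.degree m < 3) (ha : G.Adj m a)
    (hb : G.Adj m b) (hab : a ≠ b) (hc : G.Adj m c) : c = a ∨ c = b := by
  by_contra! hcon
  have : ({a, b, c} : Finset V) ⊆ G.neighborFinset m := by
    intro x hx
    simp only [Finset.mem_insert, Finset.mem_singleton] at hx
    rcases hx with rfl | rfl | rfl <;> simpa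
  have := Finset.card_le_card this
  rw [Finset.card_eq_three.2 ⟨a, b, c, hab, hcon.1.symm, hcon.2.symm, rfl⟩,
    card_neighborFinset_eq_degree] at this
  omega

/-- Every branch of a finite tree contains a leaf. -/
theorem IsTree.exists_isLeaf_mem_branch (hG : G.IsTree) {u a : V} (ha : G.Adj u a) :
    ∃ t ∈ G.branch u a, G.IsLeaf t := by
  obtain ⟨t, ht, hmax⟩ := (Set.toFinite (G.branch u a)).exists_maximalFor (G.dist u) _
    ⟨a, mem_branch_self ha⟩
  refine ⟨t, ht, ?_⟩
  have hut : u ≠ t := by rintro rfl; simp [mem_branch] at ht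
  obtain ⟨z, htz, hz⟩ := hG.connected.exists_mem_branch hut
  have hpos : 0 < G.degree t := (G.degree_pos_iff_exists_adj t).2 ⟨z, htz⟩
  by_contra hdeg
  obtain ⟨c, hc, hcz⟩ := exists_adj_ne_of_two_le_degree
    (show 2 ≤ G.degree t by rw [IsLeaf] at hdeg; omega) z
  have hu : u ∉ G.branch t c := fun h => hcz (hG.eq_of_mem_branch hc htz h hz)
  obtain ⟨h₁, h₂⟩ := hG.branch_subset ht hc hu (mem_branch_self hc) ha
  rw [dist_eq_one_iff_adj.2 hc] at h₂
  have := hmax h₁ (by omega)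
  omega

/-- A major vertex with a branch free of major vertices is an exterior major vertex. -/
theorem IsTree.isExteriorMajor_of_branch (hG : G.IsTree) {u a : V} (ha : G.Adj u a)
    (hu : G.IsMajor u) (h : ∀ x ∈ G.branch u a, ¬ G.IsMajor x) : G.IsExteriorMajor u := by
  obtain ⟨t, ht, hleaf⟩ := hG.exists_isLeaf_mem_branch ha
  refine ⟨hu, ?_⟩
  rw [terDegree, Set.ncard_pos]
  refine ⟨t, hleaf, hu, fun w hw hwu => ?_⟩
  have h₁ := hG.dist_eq_add_of_mem_branch ha (fun hmem => h w hmem hw) ht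
  have h₂ := hG.connected.pos_dist_of_ne hwu
  have := G.dist_comm (u := t) (v := u)
  have := G.dist_comm (u := t) (v := w)
  omega

/-- If each major vertex has at most one branch avoiding `W` and the major vertices, then every
branch containing a major vertex meets `W`. -/
theorem IsTree.not_isMajor_of_disjoint_branch (hG : G.IsTree) {W : Set V}
    (h : ∀ u a b, G.IsMajor u → G.Adj u a → G.Adj u b →
      (∀ x ∈ G.branch u a, ¬ G.IsMajor x ∧ x ∉ W) →
      (∀ x ∈ G.branch u b, ¬ G.IsMajor x ∧ x ∉ W) → a = b)
    {m a : V} (ha : G.Adj m a) (hW : ∀ x ∈ G.branch m a, x ∉ W) :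
    ∀ x ∈ G.branch m a, ¬ G.IsMajor x := by
  intro x hx hxM
  obtain ⟨u, ⟨hu, huM⟩, hmax⟩ :=
    (Set.toFinite {x | x ∈ G.branch m a ∧ G.IsMajor x}).exists_maximalFor (G.dist m) _
      ⟨x, hx, hxM⟩
  have hmu : m ≠ u := by rintro rfl; simp [mem_branch] at hu
  obtain ⟨z, hz, hmz⟩ := hG.connected.exists_mem_branch hmu
  have key : ∀ c, G.Adj u c → c ≠ z → ∀ x ∈ G.branch u c, ¬ G.IsMajor x ∧ x ∉ W := by
    intro c hc hcz x hx
    have hm : m ∉ G.branch u c := fun hm => hcz (hG.eq_of_mem_branch hc hz hm hmz)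
    obtain ⟨h₁, h₂⟩ := hG.branch_subset hu hc hm hx ha
    refine ⟨fun hM => ?_, hW x h₁⟩
    have h₃ := hmax ⟨h₁, hM⟩ (by omega)
    have : u ≠ x := by rintro rfl; simp [mem_branch] at hx
    have := hG.connected.pos_dist_of_ne this
    omega
  obtain ⟨c, hc, hcz, -⟩ := exists_adj_ne_of_three_le_degree huM z z
  obtain ⟨c', hc', hcz', hne⟩ := exists_adj_ne_of_three_le_degree huM z c
  exact hne (h u c' c huM hc' hc (key c' hc' hcz') (key c hc hcz))

/-- A criterion for a set to resolve a tree that has a major vertex. -/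
theorem IsTree.uResolves_of_isMajor (hG : G.IsTree) {W : Set V} (hne : W.Nonempty) {v : V}
    (hv : G.IsMajor v)
    (h : ∀ u a b, G.IsMajor u → G.Adj u a → G.Adj u b →
      (∀ x ∈ G.branch u a, ¬ G.IsMajor x ∧ x ∉ W) →
      (∀ x ∈ G.branch u b, ¬ G.IsMajor x ∧ x ∉ W) → a = b) :
    G.UResolves W := by
  intro x y hxy
  by_contra hne'
  obtain ⟨w₀, hw₀⟩ := hne
  obtain ⟨m, a, b, ha, hb, hab, hWa, hWb⟩ := hG.exists_disjoint_branches hw₀ hne' hxy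
  have hWa' : ∀ x ∈ G.branch m a, x ∉ W := fun x hx hxW => hWa x hxW hx
  have hWb' : ∀ x ∈ G.branch m b, x ∉ W := fun x hx hxW => hWb x hxW hx
  have hMa := hG.not_isMajor_of_disjoint_branch h ha hWa'
  have hMb := hG.not_isMajor_of_disjoint_branch h hb hWb'
  by_cases hm : G.IsMajor m
  · exact hab (h m a b hm ha hb (fun x hx => ⟨hMa x hx, hWa' x hx⟩)
      fun x hx => ⟨hMb x hx, hWb' x hx⟩)
  · have hvm : v ≠ m := by rintro rfl; exact hm hv
    obtain ⟨c, hc, hvc⟩ := hG.connected.exists_mem_branch hvm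
    rcases eq_or_eq_of_degree_lt_three (not_le.1 hm) ha hb hab hc with rfl | rfl
    · exact hMa v hvc hv
    · exact hMb v hvc hv

/-- A leaf resolves a tree without major vertices, that is, a path. -/
theorem IsTree.uResolves_singleton_of_isLeaf (hG : G.IsTree) (h : ∀ v, ¬ G.IsMajor v) {t : V}
    (ht : G.IsLeaf t) : G.UResolves {t} := by
  intro x y hxy
  by_contra hne
  obtain ⟨m, a, b, ha, hb, hab, hWa, hWb⟩ :=
    hG.exists_disjoint_branches (Set.mem_singleton t) hne hxy
  have htm : t ≠ m := by
    rintro rfl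
    have : G.degree t = 1 := ht
    rw [degree_eq_one_iff_existsUnique_adj] at this
    exact hab (this.unique ha hb)
  obtain ⟨c, hc, htc⟩ := hG.connected.exists_mem_branch htm
  rcases eq_or_eq_of_degree_lt_three (not_le.1 (h m)) ha hb hab hc with rfl | rfl
  · exact hWa t rfl htc
  · exact hWb t rfl htc

end Degree

/-! ### Signed distances -/

section Signed

variable {V : Type*} {G : SimpleGraph V} {σ : Sym2 V → ℤ}

theorem natAbs_sdist_s14 (u v : V) : (G.sdist σ u v).natAbs = G.dist u v := by
  rw [sdist, dmax, Int.natAbs_mul, sigmaMax]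
  split_ifs <;> simp

theorem UResolves.sResolves {W : Set V} (h : G.UResolves W) : G.SResolves σ W := fun u v huv =>
  h u v fun w hw => by rw [← natAbs_sdist_s14 (σ := σ) u, huv w hw, natAbs_sdist_s14]

theorem uResolves_univ (hG : G.Connected) : G.UResolves Set.univ := fun u v h => by
  have := h v trivial
  rwa [dist_self, hG.dist_eq_zero_iff] at this

theorem walkSign_eq_one_or_neg_one (hσ : ∀ e ∈ G.edgeSet, σ e = 1 ∨ σ e = -1) {u v : V}
    (p : G.Walk u v) : walkSign σ p = 1 ∨ walkSign σ p = -1 := by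
  induction p with
  | nil => simp [walkSign]
  | cons h p ih =>
    have h₁ := hσ _ (G.mem_edgeSet.2 h)
    simp only [walkSign, Walk.edges_cons, List.map_cons, List.prod_cons] at ih ⊢
    rcases h₁ with h₁ | h₁ <;> rcases ih with ih | ih <;> simp [h₁, ih]

theorem IsTree.sigmaMax_eq_walkSign (hG : G.IsTree)
    (hσ : ∀ e ∈ G.edgeSet, σ e = 1 ∨ σ e = -1) {u v : V} {p : G.Walk u v}
    (hp : p.length = G.dist u v) : G.sigmaMax σ u v = walkSign σ p := by
  rw [sigmaMax]
  split_ifs with h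
  · exact (h p hp).symm
  · refine ((walkSign_eq_one_or_neg_one hσ p).resolve_right fun h' => h fun q hq => ?_).symm
    rwa [hG.walk_eq_of_length_eq_dist hq hp]

theorem IsTree.sdist_of_notMem_branch (hG : G.IsTree)
    (hσ : ∀ e ∈ G.edgeSet, σ e = 1 ∨ σ e = -1) {u a w : V} (ha : G.Adj u a)
    (hw : w ∉ G.branch u a) :
    G.sdist σ a w = σ s(u, a) * G.sigmaMax σ u w * (G.dist u w + 1) := by
  obtain ⟨p, hp⟩ := hG.connected.exists_walk_length_eq_dist u w
  have hd := hG.dist_eq_of_notMem_branch ha hw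
  rw [dist_comm, G.dist_comm (u := w)] at hd
  have hq : (Walk.cons ha.symm p).length = G.dist a w := by simp [hp, hd]
  rw [sdist, dmax, hG.sigmaMax_eq_walkSign hσ hq, hG.sigmaMax_eq_walkSign hσ hp, hd]
  simp [walkSign, Sym2.eq_swap]

theorem SResolves.eq_of_disjoint_branches {W : Set V} (hW : G.SResolves σ W) (hG : G.IsTree)
    (hσ : ∀ e ∈ G.edgeSet, σ e = 1 ∨ σ e = -1) {u a b : V} (ha : G.Adj u a) (hb : G.Adj u b)
    (hWa : ∀ x ∈ G.branch u a, x ∉ W) (hWb : ∀ x ∈ G.branch u b, x ∉ W)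
    (hab : σ s(u, a) = σ s(u, b)) : a = b :=
  hW a b fun w hw => by
    rw [hG.sdist_of_notMem_branch hσ ha fun h => hWa w h hw,
      hG.sdist_of_notMem_branch hσ hb fun h => hWb w h hw, hab]

end Signed

/-! ### Metric dimensions -/

section Dimension

variable {V : Type*} [Fintype V] {G : SimpleGraph V} {σ : Sym2 V → ℤ}

theorem udim_le_card {W : Finset V} (h : G.UResolves ↑W) : G.udim ≤ W.card :=
  Nat.sInf_le ⟨W, rfl, h⟩

theorem sdim_le_card {W : Finset V} (h : G.SResolves σ ↑W) : G.sdim σ ≤ W.card :=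
  Nat.sInf_le ⟨W, rfl, h⟩

theorem Connected.exists_card_eq_udim (hG : G.Connected) :
    ∃ W : Finset V, W.card = G.udim ∧ G.UResolves ↑W :=
  Nat.sInf_mem (s := {k | ∃ W : Finset V, W.card = k ∧ G.UResolves ↑W})
    ⟨_, Finset.univ, rfl, by simpa using uResolves_univ hG⟩

theorem Connected.exists_card_eq_sdim (hG : G.Connected) (σ : Sym2 V → ℤ) :
    ∃ W : Finset V, W.card = G.sdim σ ∧ G.SResolves σ ↑W :=
  Nat.sInf_mem (s := {k | ∃ W : Finset V, W.card = k ∧ G.SResolves σ ↑W})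
    ⟨_, Finset.univ, rfl, by simpa using (uResolves_univ hG).sResolves⟩

theorem Connected.sdim_le_udim (hG : G.Connected) (σ : Sym2 V → ℤ) : G.sdim σ ≤ G.udim := by
  obtain ⟨W, hW, h⟩ := hG.exists_card_eq_udim
  exact hW ▸ sdim_le_card h.sResolves

/-- A signed resolving set of a tree with a major vertex becomes resolving after adding at most
one vertex for each exterior major vertex. -/
theorem IsTree.exists_uResolves_card_le (hG : G.IsTree)
    (hσ : ∀ e ∈ G.edgeSet, σ e = 1 ∨ σ e = -1) {W : Finset V} (hne : W.Nonempty)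
    (hW : G.SResolves σ ↑W) {v : V} (hv : G.IsMajor v) :
    ∃ W' : Finset V, G.UResolves ↑W' ∧ W'.card ≤ W.card + G.extMajor := by
  let P : V → V → Prop := fun u a => G.IsMajor u ∧ G.Adj u a ∧
    (∀ x ∈ G.branch u a, ¬ G.IsMajor x ∧ x ∉ W) ∧ σ s(u, a) = -1
  have hP : ∀ u a b, P u a → P u b → a = b := fun u a b ha hb =>
    hW.eq_of_disjoint_branches hG hσ ha.2.1 hb.2.1 (fun x hx => (ha.2.2.1 x hx).2)
      (fun x hx => (hb.2.2.1 x hx).2) (ha.2.2.2.trans hb.2.2.2.symm)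
  let D : Finset V := {a | ∃ u, P u a}
  have hD : D.card ≤ G.extMajor := by
    have hex : ∀ a : D, ∃ u, P u a := fun a => (Finset.mem_filter.1 a.2).2
    choose f hf using hex
    rw [extMajor, ← Nat.card_coe_set_eq, ← Nat.card_eq_finsetCard]
    refine Nat.card_le_card_of_injective (fun a : D => (⟨f a, hG.isExteriorMajor_of_branch
      (hf a).2.1 (hf a).1 fun x hx => ((hf a).2.2.1 x hx).1⟩ : {v | G.IsExteriorMajor v})) ?_
    intro a b hab
    have hab' : f a = f b := congrArg Subtype.val hab
    exact Subtype.ext (hP (f a) a b (hf a) (hab' ▸ hf b))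
  refine ⟨W ∪ D, hG.uResolves_of_isMajor ?_ hv ?_,
    (Finset.card_union_le _ _).trans (Nat.add_le_add_left hD _)⟩
  · exact hne.mono Finset.subset_union_left
  · intro u a b hu ha hb hWa hWb
    simp only [Finset.coe_union, Set.mem_union, Finset.mem_coe, not_or] at hWa hWb
    have key : ∀ a, G.Adj u a → (∀ x ∈ G.branch u a, ¬ G.IsMajor x ∧ x ∉ W ∧ x ∉ D) →
        σ s(u, a) = 1 := by
      intro a ha h
      refine (hσ _ (G.mem_edgeSet.2 ha)).resolve_right fun hneg => ?_
      exact (h a (mem_branch_self ha)).2.2 (Finset.mem_filter.2 ⟨Finset.mem_univ _, u, hu, ha,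
        fun x hx => ⟨(h x hx).1, (h x hx).2.1⟩, hneg⟩)
    exact hW.eq_of_disjoint_branches hG hσ ha hb (fun x hx => (hWa x hx).2.1)
      (fun x hx => (hWb x hx).2.1) ((key a ha hWa).trans (key b hb hWb).symm)

theorem IsTree.udim_le_sdim_add_extMajor (hG : G.IsTree)
    (hσ : ∀ e ∈ G.edgeSet, σ e = 1 ∨ σ e = -1) : G.udim ≤ G.sdim σ + G.extMajor := by
  obtain ⟨W, hcard, hW⟩ := hG.connected.exists_card_eq_sdim σ
  rw [← hcard]
  rcases W.eq_empty_or_nonempty with rfl | hne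
  · exact (udim_le_card (W := ∅) fun u v _ => hW u v (by simp)).trans (Nat.zero_le _)
  by_cases hM : ∃ v, G.IsMajor v
  · obtain ⟨v, hv⟩ := hM
    obtain ⟨W', hW', hle⟩ := hG.exists_uResolves_card_le hσ hne hW hv
    exact (udim_le_card hW').trans hle
  · push Not at hM
    rcases subsingleton_or_nontrivial V with hV | hV
    · exact (udim_le_card (W := ∅) fun u v _ => Subsingleton.elim u v).trans (Nat.zero_le _)
    · obtain ⟨t, ht⟩ := hG.exists_vert_degree_one_of_nontrivial
      have h₁ := udim_le_card (W := {t})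
        (by simpa using hG.uResolves_singleton_of_isLeaf hM ht)
      have := hne.card_pos
      rw [Finset.card_singleton] at h₁
      omega

end Dimension

end SimpleGraph

/-- For every signed tree `T^σ`, `dim(T) - ext(T) ≤ dim(T^σ) ≤ dim(T)`,
i.e. `mdd(T^σ) ≤ ext(T)`. -/
theorem sdim_signed_tree_bounds (V : Type*) [Fintype V]
    (G : SimpleGraph V) (htree : G.IsTree)
    (σ : Sym2 V → ℤ) (hσ : ∀ e ∈ G.edgeSet, σ e = 1 ∨ σ e = -1) :
    G.udim - G.extMajor ≤ G.sdim σ ∧ G.sdim σ ≤ G.udim := by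
  exact ⟨Nat.sub_le_iff_le_add.2 (htree.udim_le_sdim_add_extMajor hσ),
    htree.connected.sdim_le_udim σ⟩
end
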